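/- Distinct vertices a and b of a finite simple graph X with adjacency matrix A are parallel if and only if all poles of the rational function φ(X∖{a,b},t)/φ(X,t) are simple; explicitly, if and only if for every real number θ, the multiplicity of θ as a root of the characteristic polynomial of A exceeds the multiplicity of θ as a root of the characteristic polynomial of the principal submatrix of A obtained by deleting the rows and columns indexed by a and b by at most one. -/

import Mathlib

open Matrix BigOperators

/-- A spectral decomposition of a real symmetric matrix `A`: the `θ r` are the distinct
eigenvalues and `E r` is the orthogonal projection onto the `θ r`-eigenspace. -/
structure IsSpectralDecomp {V : Type*} [Fintype V] [DecidableEq V] (A : Matrix V V ℝ)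
    {m : ℕ} (θ : Fin m → ℝ) (E : Fin m → Matrix V V ℝ) : Prop where
  theta_inj : Function.Injective θ
  symm : ∀ r, (E r)ᵀ = E r
  idem : ∀ r, E r * E r = E r
  mul_eq_zero : ∀ r s, r ≠ s → E r * E s = 0
  sum_eq_one : ∑ r, E r = 1
  eq_sum : A = ∑ r, θ r • E r
  ne_zero : ∀ r, E r ≠ 0

open Module

namespace Matrix

variable {V : Type*} [Fintype V]

theorem IsSymm.mulVec_eq_zero_of_mulVec_mulVec_eq_zero {N : Matrix V V ℝ} (hN : N.IsSymm)
    {y : V → ℝ} (h : N *ᵥ (N *ᵥ y) = 0) : N *ᵥ y = 0 := by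
  rw [← dotProduct_self_eq_zero, dotProduct_mulVec, ← mulVec_transpose, hN.eq, h,
    zero_dotProduct]

theorem submatrix_mulVec_comp_val {p : V → Prop} [DecidablePred p] (A : Matrix V V ℝ)
    {x : V → ℝ} (hx : ∀ i, ¬ p i → x i = 0) (i : Subtype p) :
    (A.submatrix (fun j : Subtype p => (j : V)) (fun j : Subtype p => (j : V)) *ᵥ
      fun j : Subtype p => x j) i =
      (A *ᵥ x) i := by
  simp only [mulVec, dotProduct, submatrix_apply]
  rw [← Fintype.sum_subtype_add_sum_subtype p (fun j => A i j * x j)]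
  simp [fun j : {j // ¬ p j} => hx j j.2]

variable [DecidableEq V]

theorem mem_eigenspace_toLin'_iff {A : Matrix V V ℝ} {μ : ℝ} {x : V → ℝ} :
    x ∈ End.eigenspace (toLin' A) μ ↔ A *ᵥ x = μ • x := by
  rw [End.mem_eigenspace_iff, toLin'_apply]

/-- The algebraic and geometric multiplicities of an eigenvalue of a real symmetric matrix agree. -/
theorem IsSymm.rootMultiplicity_charpoly {A : Matrix V V ℝ} (hA : A.IsSymm) (μ : ℝ) :
    A.charpoly.rootMultiplicity μ = finrank ℝ (End.eigenspace (toLin' A) μ) := by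
  have hN : (A - μ • (1 : Matrix V V ℝ)).IsSymm := hA.sub (isSymm_one.smul μ)
  have hsub : toLin' A - μ • (1 : End ℝ (V → ℝ)) = toLin' (A - μ • 1) := by
    simp [map_sub, toLin'_one, End.one_eq_id]
  have hmax : End.maxGenEigenspace (toLin' A) μ = End.eigenspace (toLin' A) μ := by
    refine le_antisymm (fun x hx => ?_) ((End.genEigenspace _ _).monotone le_top)
    obtain ⟨k, hk⟩ := End.mem_maxGenEigenspace _ _ _ |>.1 hx
    rw [hsub] at hk
    suffices (A - μ • 1) *ᵥ x = 0 by
      rw [mem_eigenspace_toLin'_iff, ← sub_eq_zero]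
      simpa [sub_mulVec, smul_mulVec] using this
    induction k with
    | zero =>
      have hx0 : x = 0 := by simpa using hk
      simp [hx0]
    | succ k ih =>
      rcases k with _ | k
      · simpa only [zero_add, pow_one, toLin'_apply] using hk
      · refine ih ?_
        rw [pow_succ', pow_succ', End.mul_apply, End.mul_apply, toLin'_apply, toLin'_apply] at hk
        rw [pow_succ', End.mul_apply, toLin'_apply]
        exact hN.mulVec_eq_zero_of_mulVec_mulVec_eq_zero hk
  rw [← hmax, LinearMap.finrank_maxGenEigenspace_eq, charpoly_toLin']

/-- Evaluation at the vertices `a` and `b` on the `μ`-eigenspace of `A`. -/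
noncomputable def eigenspaceEvalPair (A : Matrix V V ℝ) (μ : ℝ) (a b : V) :
    End.eigenspace (toLin' A) μ →ₗ[ℝ] ℝ × ℝ :=
  ((LinearMap.proj a).prod (LinearMap.proj b)).comp (Submodule.subtype _)

@[simp]
theorem eigenspaceEvalPair_apply (A : Matrix V V ℝ) (μ : ℝ) (a b : V)
    (x : End.eigenspace (toLin' A) μ) :
    eigenspaceEvalPair A μ a b x = ((x : V → ℝ) a, (x : V → ℝ) b) :=
  rfl

/-- The principal submatrix of `A` obtained by deleting the rows and columns `a` and `b`. -/
abbrev deletePair (A : Matrix V V ℝ) (a b : V) :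
    Matrix {x : V // x ≠ a ∧ x ≠ b} {x : V // x ≠ a ∧ x ≠ b} ℝ :=
  A.submatrix (fun i => (i : V)) (fun i => (i : V))

theorem finrank_ker_eigenspaceEvalPair_le (A : Matrix V V ℝ) (μ : ℝ) (a b : V) :
    finrank ℝ (LinearMap.ker (eigenspaceEvalPair A μ a b)) ≤
      finrank ℝ (End.eigenspace (toLin' (A.deletePair a b)) μ) := by
  have hvanish (x : LinearMap.ker (eigenspaceEvalPair A μ a b)) (i : V)
      (hi : ¬ (i ≠ a ∧ i ≠ b)) : (x : V → ℝ) i = 0 := by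
    have hx := x.2
    simp only [LinearMap.mem_ker, eigenspaceEvalPair_apply, Prod.mk_eq_zero] at hx
    by_cases hia : i = a
    · exact hia ▸ hx.1
    · have hib : i = b := by tauto
      exact hib ▸ hx.2
  let g := ((LinearMap.funLeft ℝ ℝ (Subtype.val : {x : V // x ≠ a ∧ x ≠ b} → V)).comp
    ((Submodule.subtype _).comp (LinearMap.ker (eigenspaceEvalPair A μ a b)).subtype)).codRestrict
      (End.eigenspace (toLin' (A.deletePair a b)) μ) (fun x => by
        rw [mem_eigenspace_toLin'_iff]
        ext i
        have h := submatrix_mulVec_comp_val A (hvanish x) i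
        rw [mem_eigenspace_toLin'_iff.1 x.1.2] at h
        exact h)
  refine LinearMap.finrank_le_finrank_of_injective (f := g) fun x y hxy => ?_
  ext i
  by_cases hi : i ≠ a ∧ i ≠ b
  · exact congrFun (congrArg Subtype.val hxy) ⟨i, hi⟩
  · rw [hvanish x i hi, hvanish y i hi]

/-- An eigenvector of `A.deletePair a b`, extended by zero, is an eigenvector of `A` as soon as
no nonzero combination of `e_a` and `e_b` is orthogonal to the eigenspace of `A`. -/
theorem finrank_eigenspace_deletePair_le {A : Matrix V V ℝ} (hA : A.IsSymm) {μ : ℝ} {a b : V}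
    (hsurj : Function.Surjective (eigenspaceEvalPair A μ a b)) :
    finrank ℝ (End.eigenspace (toLin' (A.deletePair a b)) μ) ≤
      finrank ℝ (LinearMap.ker (eigenspaceEvalPair A μ a b)) := by
  let ext0 := Function.ExtendByZero.linearMap ℝ (Subtype.val : {x : V // x ≠ a ∧ x ≠ b} → V)
  have ext0_val (y : {x : V // x ≠ a ∧ x ≠ b} → ℝ) (i : {x : V // x ≠ a ∧ x ≠ b}) :
      ext0 y i = y i := Subtype.val_injective.extend_apply y 0 i
  have ext0_of_not (y : {x : V // x ≠ a ∧ x ≠ b} → ℝ) (i : V) (hi : ¬ (i ≠ a ∧ i ≠ b)) :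
      ext0 y i = 0 :=
    Function.extend_apply' (f := Subtype.val) y 0 i (by rintro ⟨j, rfl⟩; exact hi j.2)
  have hmem (y : End.eigenspace (toLin' (A.deletePair a b)) μ) :
      ext0 y ∈ End.eigenspace (toLin' A) μ := by
    set z := A *ᵥ ext0 y - μ • ext0 y with hz
    have hz_off (i : V) (hi : i ≠ a ∧ i ≠ b) : z i = 0 := by
      have h := submatrix_mulVec_comp_val A (ext0_of_not y) ⟨i, hi⟩
      have hcomp : (fun j : {x : V // x ≠ a ∧ x ≠ b} => ext0 y j) = y := funext (ext0_val y)
      rw [hcomp] at h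
      have h2 := congrFun (mem_eigenspace_toLin'_iff.1 y.2) ⟨i, hi⟩
      have h3 := ext0_val y ⟨i, hi⟩
      simp only [Pi.smul_apply, ← h3] at h2
      simp only [hz, Pi.sub_apply, Pi.smul_apply, ← h2]
      exact sub_eq_zero.2 h.symm
    obtain ⟨x, hx⟩ := hsurj (z a, z b)
    have hxa : (x : V → ℝ) a = z a := congrArg Prod.fst hx
    have hxb : (x : V → ℝ) b = z b := congrArg Prod.snd hx
    have horth : (x : V → ℝ) ⬝ᵥ z = 0 := by
      rw [hz, dotProduct_sub, dotProduct_mulVec, ← mulVec_transpose, hA.eq,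
        mem_eigenspace_toLin'_iff.1 x.2, smul_dotProduct, dotProduct_smul, sub_self]
    have hxz : (x : V → ℝ) ⬝ᵥ z = z ⬝ᵥ z := by
      refine Finset.sum_congr rfl fun i _ => ?_
      by_cases hi : i ≠ a ∧ i ≠ b
      · simp [hz_off i hi]
      · by_cases hia : i = a
        · rw [hia, hxa]
        · have hib : i = b := by tauto
          rw [hib, hxb]
    rw [hxz, dotProduct_self_eq_zero] at horth
    exact mem_eigenspace_toLin'_iff.2 (sub_eq_zero.1 horth)
  let g := ((ext0.comp (Submodule.subtype _)).codRestrict _ hmem).codRestrict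
    (LinearMap.ker (eigenspaceEvalPair A μ a b)) (fun y =>
      Prod.ext (ext0_of_not y a (by simp)) (ext0_of_not y b (by simp)))
  refine LinearMap.finrank_le_finrank_of_injective (f := g) fun x y hxy => ?_
  ext i
  rw [← ext0_val x, ← ext0_val y]
  exact congrFun (congrArg (fun w => (w.1.1 : V → ℝ)) hxy) i

end Matrix

namespace IsSpectralDecomp

variable {V : Type*} [Fintype V] [DecidableEq V] {A : Matrix V V ℝ} {m : ℕ} {θ : Fin m → ℝ}
  {E : Fin m → Matrix V V ℝ}

theorem idem_mul (h : IsSpectralDecomp A θ E) (r : Fin m) : E r * A = θ r • E r := by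
  rw [h.eq_sum, Finset.mul_sum, Finset.sum_eq_single r]
  · rw [mul_smul_comm, h.idem]
  · intro s _ hs
    rw [mul_smul_comm, h.mul_eq_zero r s hs.symm, smul_zero]
  · simp

theorem mul_idem (h : IsSpectralDecomp A θ E) (r : Fin m) : A * E r = θ r • E r := by
  rw [h.eq_sum, Finset.sum_mul, Finset.sum_eq_single r]
  · rw [smul_mul_assoc, h.idem]
  · intro s _ hs
    rw [smul_mul_assoc, h.mul_eq_zero s r hs, smul_zero]
  · simp

theorem mulVec_mem_eigenspace (h : IsSpectralDecomp A θ E) (r : Fin m) (x : V → ℝ) :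
    E r *ᵥ x ∈ End.eigenspace (toLin' A) (θ r) := by
  rw [mem_eigenspace_toLin'_iff, mulVec_mulVec, h.mul_idem, smul_mulVec]

theorem mulVec_eq_zero (h : IsSpectralDecomp A θ E) {r : Fin m} {μ : ℝ} (hr : θ r ≠ μ)
    {x : V → ℝ} (hx : x ∈ End.eigenspace (toLin' A) μ) : E r *ᵥ x = 0 := by
  have h1 : E r *ᵥ (A *ᵥ x) = θ r • (E r *ᵥ x) := by
    rw [mulVec_mulVec, h.idem_mul, smul_mulVec]
  rw [mem_eigenspace_toLin'_iff.1 hx, mulVec_smul, ← sub_eq_zero, ← sub_smul] at h1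
  exact (smul_eq_zero.1 h1).resolve_left (sub_ne_zero.2 hr.symm)

theorem sum_mulVec_eq_self (h : IsSpectralDecomp A θ E) (x : V → ℝ) : ∑ r, E r *ᵥ x = x := by
  rw [← Matrix.sum_mulVec, h.sum_eq_one, one_mulVec]

theorem mulVec_eq_self (h : IsSpectralDecomp A θ E) {r : Fin m} {x : V → ℝ}
    (hx : x ∈ End.eigenspace (toLin' A) (θ r)) : E r *ᵥ x = x := by
  have hsum : ∑ s, E s *ᵥ x = E r *ᵥ x :=
    Fintype.sum_eq_single r fun s hs => h.mulVec_eq_zero (h.theta_inj.ne hs) hx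
  rw [← hsum, h.sum_mulVec_eq_self]

theorem eigenspace_eq_bot (h : IsSpectralDecomp A θ E) {μ : ℝ} (hμ : ∀ r, θ r ≠ μ) :
    End.eigenspace (toLin' A) μ = ⊥ := by
  refine (Submodule.eq_bot_iff _).2 fun x hx => ?_
  rw [← h.sum_mulVec_eq_self x]
  exact Finset.sum_eq_zero fun r _ => h.mulVec_eq_zero (hμ r) hx

theorem mulVec_single_dotProduct (h : IsSpectralDecomp A θ E) {r : Fin m} {x : V → ℝ}
    (hx : x ∈ End.eigenspace (toLin' A) (θ r)) (v : V) :
    (E r *ᵥ Pi.single v 1) ⬝ᵥ x = x v := by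
  rw [← vecMul_transpose, ← dotProduct_mulVec, h.symm, h.mulVec_eq_self hx,
    single_one_dotProduct]

theorem finrank_range_eigenspaceEvalPair_le_one (h : IsSpectralDecomp A θ E) {r : Fin m} {a b : V}
    (hpar : (∃ c : ℝ, E r *ᵥ Pi.single a 1 = c • (E r *ᵥ Pi.single b 1)) ∨
      (∃ c : ℝ, E r *ᵥ Pi.single b 1 = c • (E r *ᵥ Pi.single a 1))) :
    finrank ℝ (LinearMap.range (eigenspaceEvalPair A (θ r) a b)) ≤ 1 := by
  suffices ∃ w : ℝ × ℝ, LinearMap.range (eigenspaceEvalPair A (θ r) a b) ≤ ℝ ∙ w by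
    obtain ⟨w, hw⟩ := this
    exact (Submodule.finrank_mono hw).trans ((finrank_span_le_card {w}).trans (by simp))
  rcases hpar with ⟨c, hc⟩ | ⟨c, hc⟩
  · refine ⟨(c, 1), ?_⟩
    rintro _ ⟨x, rfl⟩
    refine Submodule.mem_span_singleton.2 ⟨(x : V → ℝ) b, ?_⟩
    have hx := h.mulVec_single_dotProduct x.2 a
    rw [hc, smul_dotProduct, h.mulVec_single_dotProduct x.2] at hx
    simp [← hx, mul_comm]
  · refine ⟨(1, c), ?_⟩
    rintro _ ⟨x, rfl⟩
    refine Submodule.mem_span_singleton.2 ⟨(x : V → ℝ) a, ?_⟩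
    have hx := h.mulVec_single_dotProduct x.2 b
    rw [hc, smul_dotProduct, h.mulVec_single_dotProduct x.2] at hx
    simp [← hx, mul_comm]

theorem surjective_eigenspaceEvalPair (h : IsSpectralDecomp A θ E) {r : Fin m} {a b : V}
    (hpar : ¬ ((∃ c : ℝ, E r *ᵥ Pi.single a 1 = c • (E r *ᵥ Pi.single b 1)) ∨
      (∃ c : ℝ, E r *ᵥ Pi.single b 1 = c • (E r *ᵥ Pi.single a 1)))) :
    Function.Surjective (eigenspaceEvalPair A (θ r) a b) := by
  rw [← LinearMap.range_eq_top]
  by_contra hne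
  obtain ⟨f, hf0, hf⟩ := Submodule.exists_le_ker_of_lt_top _ (lt_top_iff_ne_top.2 hne)
  have hf_apply (s t : ℝ) : f (s, t) = s * f (1, 0) + t * f (0, 1) := by
    rw [← smul_eq_mul, ← smul_eq_mul, ← map_smul, ← map_smul, ← map_add]
    simp
  set α := f (1, 0)
  set β := f (0, 1)
  set z := α • (E r *ᵥ Pi.single a 1) + β • (E r *ᵥ Pi.single b 1) with hz
  have hzmem : z ∈ End.eigenspace (toLin' A) (θ r) :=
    add_mem (Submodule.smul_mem _ _ (h.mulVec_mem_eigenspace r _))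
      (Submodule.smul_mem _ _ (h.mulVec_mem_eigenspace r _))
  have hfz : f (z a, z b) = 0 := hf ⟨⟨z, hzmem⟩, rfl⟩
  have hzz : z ⬝ᵥ z = 0 := by
    conv_lhs => rw [hz]
    rw [← hz, add_dotProduct, smul_dotProduct, smul_dotProduct,
      h.mulVec_single_dotProduct hzmem, h.mulVec_single_dotProduct hzmem, ← hfz, hf_apply,
      smul_eq_mul, smul_eq_mul, mul_comm α, mul_comm β]
  have hz0 := dotProduct_self_eq_zero.1 hzz
  rw [hz] at hz0
  apply hpar
  by_cases hα : α = 0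
  · have hβ : β ≠ 0 := fun hβ => hf0 <| LinearMap.ext fun ⟨s, t⟩ => by
      simp [hf_apply s t, hα, hβ]
    refine Or.inr ⟨0, ?_⟩
    rw [hα, zero_smul, zero_add] at hz0
    rw [(smul_eq_zero.1 hz0).resolve_left hβ, zero_smul]
  · refine Or.inl ⟨-(α⁻¹ * β), ?_⟩
    rw [neg_smul, mul_smul, ← smul_neg, ← eq_neg_of_add_eq_zero_left hz0, smul_smul,
      inv_mul_cancel₀ hα, one_smul]

end IsSpectralDecomp

/-- Distinct vertices `a` and `b` are parallel iff all poles of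
`φ(X∖{a,b},t)/φ(X,t)` are simple. -/
theorem parallel_iff_simple_poles {V : Type*} [Fintype V] [DecidableEq V]
    (X : SimpleGraph V) [DecidableRel X.Adj] {m : ℕ} (θ : Fin m → ℝ)
    (E : Fin m → Matrix V V ℝ) (hdec : IsSpectralDecomp (X.adjMatrix ℝ) θ E)
    (a b : V) (hab : a ≠ b) :
    (∀ r,
        (∃ c : ℝ, E r *ᵥ Pi.single a 1 = c • (E r *ᵥ Pi.single b 1)) ∨
        (∃ c : ℝ, E r *ᵥ Pi.single b 1 = c • (E r *ᵥ Pi.single a 1))) ↔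
      ∀ θ' : ℝ,
        (X.adjMatrix ℝ).charpoly.rootMultiplicity θ' ≤
          ((X.adjMatrix ℝ).submatrix (fun i : {x : V // x ≠ a ∧ x ≠ b} => (i : V))
            (fun i : {x : V // x ≠ a ∧ x ≠ b} => (i : V))).charpoly.rootMultiplicity θ' + 1 := by
  have hA : (X.adjMatrix ℝ).IsSymm := X.isSymm_adjMatrix
  have hB : ((X.adjMatrix ℝ).deletePair a b).IsSymm := hA.submatrix _
  have hrank (μ : ℝ) := LinearMap.finrank_range_add_finrank_ker
    (eigenspaceEvalPair (X.adjMatrix ℝ) μ a b)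
  constructor
  · intro hpar μ
    rw [hA.rootMultiplicity_charpoly, hB.rootMultiplicity_charpoly]
    by_cases hμ : ∃ r, θ r = μ
    · obtain ⟨r, rfl⟩ := hμ
      have hrange := hdec.finrank_range_eigenspaceEvalPair_le_one (hpar r)
      have hker := finrank_ker_eigenspaceEvalPair_le (X.adjMatrix ℝ) (θ r) a b
      have := hrank (θ r)
      lia
    · rw [hdec.eigenspace_eq_bot (not_exists.1 hμ), finrank_bot]
      exact Nat.zero_le _
  · intro hle r
    by_contra hpar
    have hsurj := hdec.surjective_eigenspaceEvalPair hpar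
    have hker := finrank_eigenspace_deletePair_le hA hsurj
    have hle := hle (θ r)
    rw [hA.rootMultiplicity_charpoly, hB.rootMultiplicity_charpoly] at hle
    have := hrank (θ r)
    rw [LinearMap.range_eq_top.2 hsurj, finrank_top, finrank_prod, finrank_self] at this
    lia
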